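/- arXiv:1902.01351 — 3 statements merged into one kernel-verified Lean document; each statement's English description precedes it below -/
import Mathlib

section
/- Let d ≥ 3 and f = x^d + y^d + z^d + (a_1x + b_1y)^d + (a_2x + b_2z)^d, where a_1, b_1, a_2, b_2 are all nonzero complex numbers. Then the plane curve V : f = 0 in ℙ² is either smooth, or every singular point p of V is a node: the 3×3 Hessian matrix of f evaluated at p has rank 2. -/
open MvPolynomial

theorem aux_rank (M : Matrix (Fin 3) (Fin 3) ℂ) (p : Fin 3 → ℂ) (hp : p ≠ 0)
    (hM : M.mulVec p = 0) (h12 : M 1 2 = 0) (h02 : M 0 2 ≠ 0) (h10 : M 1 0 ≠ 0) :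
    M.rank = 2 := by
  apply le_antisymm
  · by_contra h
    have h3 : M.rank = Fintype.card (Fin 3) :=
      le_antisymm (M.rank_le_card_width) (by simp; omega)
    have hdet : M.det = 0 := Matrix.exists_mulVec_eq_zero_iff.mp ⟨p, hp, hM⟩
    have hk := LinearMap.finrank_range_add_finrank_ker M.mulVecLin
    have hr : Module.finrank ℂ (LinearMap.range M.mulVecLin) = 3 := by simpa [Matrix.rank] using h3
    rw [hr] at hk
    have : Module.finrank ℂ (LinearMap.ker M.mulVecLin) = 0 := by simpa using hk
    rw [Submodule.finrank_eq_zero] at this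
    have hm : p ∈ LinearMap.ker M.mulVecLin := by simpa using hM
    rw [this] at hm
    exact hp (by simpa using hm)
  · have hl : LinearIndependent ℂ (![M.col 0, M.col 2]) := by
      rw [LinearIndependent.pair_iff]
      intro s t h
      have h1 := congrFun h 1
      have h0 := congrFun h 0
      simp [Matrix.col, h12, h10] at h1
      simp [Matrix.col, h1, h02] at h0
      exact ⟨h1, h0⟩
    have h2 := finrank_span_eq_card hl
    rw [Matrix.rank_eq_finrank_span_cols]
    have : Fintype.card (Fin 2) = 2 := by simp
    rw [← this, ← h2]
    apply Submodule.finrank_mono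
    apply Submodule.span_mono
    rintro _ ⟨i, rfl⟩
    fin_cases i
    · exact ⟨0, rfl⟩
    · exact ⟨2, rfl⟩

/-- Let `d ≥ 3` and `f = x^d + y^d + z^d + (a₁ x + b₁ y)^d + (a₂ x + b₂ z)^d`, with
`a₁, b₁, a₂, b₂` all nonzero.  Then the plane curve `V : f = 0` is either smooth, or
every singular point of `V` is a node: at every nonzero `p` where all first partials
of `f` vanish, the `3 × 3` Hessian matrix of `f` at `p` has rank `2`. -/
theorem stmt16 (d : ℕ) (hd : 3 ≤ d) (a₁ b₁ a₂ b₂ : ℂ)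
    (ha₁ : a₁ ≠ 0) (hb₁ : b₁ ≠ 0) (ha₂ : a₂ ≠ 0) (hb₂ : b₂ ≠ 0)
    (f : MvPolynomial (Fin 3) ℂ)
    (hf : f = (X 0) ^ d + (X 1) ^ d + (X 2) ^ d
      + (C a₁ * X 0 + C b₁ * X 1) ^ d + (C a₂ * X 0 + C b₂ * X 2) ^ d) :
    ∀ p : Fin 3 → ℂ, p ≠ 0 → (∀ i, eval p (pderiv i f) = 0) →
      (Matrix.of fun i j : Fin 3 => eval p (pderiv i (pderiv j f))).rank = 2 := by
  intro p hp hs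
  obtain ⟨n, rfl⟩ : ∃ n, d = n + 2 := ⟨d - 2, by omega⟩
  have c1 : ((n : ℂ) + 2) ≠ 0 := by exact_mod_cast (by omega : n + 2 ≠ 0)
  have c2 : ((n : ℂ) + 1) ≠ 0 := by exact_mod_cast (by omega : n + 1 ≠ 0)
  have hn : n ≠ 0 := by omega
  obtain ⟨x, hx⟩ : ∃ x, x = p 0 := ⟨_, rfl⟩
  obtain ⟨y, hy⟩ : ∃ x, x = p 1 := ⟨_, rfl⟩
  obtain ⟨z, hz⟩ : ∃ x, x = p 2 := ⟨_, rfl⟩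
  have d0 : pderiv 0 f = C ((n : ℂ) + 2) * ((X 0) ^ (n+1) + C a₁ * (C a₁ * X 0 + C b₁ * X 1) ^ (n+1)
      + C a₂ * (C a₂ * X 0 + C b₂ * X 2) ^ (n+1)) := by
    subst hf
    simp [pderiv_pow, pderiv_X, Pi.single_apply]
    rw [show (C (2:ℂ) : MvPolynomial (Fin 3) ℂ) = 2 from map_ofNat C 2]
    ring
  have d1 : pderiv 1 f = C ((n : ℂ) + 2) * ((X 1) ^ (n+1) + C b₁ * (C a₁ * X 0 + C b₁ * X 1) ^ (n+1)) := by
    subst hf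
    simp [pderiv_pow, pderiv_X, Pi.single_apply]
    rw [show (C (2:ℂ) : MvPolynomial (Fin 3) ℂ) = 2 from map_ofNat C 2]
    ring
  have d2 : pderiv 2 f = C ((n : ℂ) + 2) * ((X 2) ^ (n+1) + C b₂ * (C a₂ * X 0 + C b₂ * X 2) ^ (n+1)) := by
    subst hf
    simp [pderiv_pow, pderiv_X, Pi.single_apply]
    rw [show (C (2:ℂ) : MvPolynomial (Fin 3) ℂ) = 2 from map_ofNat C 2]
    ring
  have e0 := hs 0
  have e1 := hs 1
  have e2 := hs 2
  rw [d0] at e0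
  rw [d1] at e1
  rw [d2] at e2
  simp [c1, ← hx, ← hy, ← hz] at e0 e1 e2
  have hp' : ¬ (x = 0 ∧ y = 0 ∧ z = 0) := by
    rintro ⟨h0, h1, h2⟩
    apply hp
    funext i
    fin_cases i
    · simp [← hx, h0]
    · simp [← hy, h1]
    · simp [← hz, h2]
  have hu : a₁ * x + b₁ * y ≠ 0 := by
    intro h
    have hy0 : y = 0 := by simpa [h] using e1
    have hx0 : x = 0 := by simpa [hy0, ha₁] using h
    have hz0 : z = 0 := by simpa [hy0, hx0, ha₂, hb₂] using e0
    exact hp' ⟨hx0, hy0, hz0⟩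
  have hv : a₂ * x + b₂ * z ≠ 0 := by
    intro h
    have hz0 : z = 0 := by simpa [h] using e2
    have hx0 : x = 0 := by simpa [hz0, ha₂] using h
    have hy0 : y = 0 := by simpa [hz0, hx0, ha₁, hb₁] using e0
    exact hp' ⟨hx0, hy0, hz0⟩
  apply aux_rank _ p hp
  · funext i
    fin_cases i <;> simp [Matrix.mulVec, dotProduct, Fin.sum_univ_three, d0, d1, d2, pderiv_pow, pderiv_X, Pi.single_apply, ← hx, ← hy, ← hz]
    · linear_combination ((n:ℂ)+2)*((n:ℂ)+1)*e0
    · linear_combination ((n:ℂ)+2)*((n:ℂ)+1)*e1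
    · linear_combination ((n:ℂ)+2)*((n:ℂ)+1)*e2
  · simp [d2, pderiv_pow, pderiv_X, Pi.single_apply]
  · simp [d2, pderiv_pow, pderiv_X, Pi.single_apply, ← hx, ← hz, c1, c2, hv, ha₂, hb₂]
  · simp [d0, pderiv_pow, pderiv_X, Pi.single_apply, ← hx, ← hy, c1, c2, hu, ha₁, hb₁]
end

section
/- Let d ≥ 3 and f = x^d + y^d + z^d + (a_1x + b_1y + c_1z)^d + (a_2x + b_2y + c_2z)^d, where a_1, b_1, c_1, a_2, b_2, c_2 are all nonzero complex numbers, and set m_{12} = a_1b_2 − a_2b_1, m_{13} = a_1c_2 − a_2c_1, m_{23} = b_1c_2 − b_2c_1; assume m_{12}, m_{13}, m_{23} are all nonzero. Then every singular point p = (p_1 : p_2 : p_3) of the curve V : f = 0 satisfies m_{23} p_1^{d−1} − m_{13} p_2^{d−1} + m_{12} p_3^{d−1} = 0 and has at most one vanishing coordinate; at every singular point the 3×3 Hessian matrix of f evaluated at p is nonzero (so each singularity is of type A_m for some m ≥ 1); and if some coordinate of p is zero, then the 3×3 Hessian matrix of f at p has rank 2, i.e., p is a node (A_1 singularity). -/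
open MvPolynomial

lemma gradL (d : ℕ) (a b c : ℂ) (p : Fin 3 → ℂ) (i : Fin 3) :
   eval p (pderiv i ((C a * X 0 + C b * X 1 + C c * X 2 : MvPolynomial (Fin 3) ℂ) ^ d)) =
    d * (a * p 0 + b * p 1 + c * p 2)^(d-1) * (![a,b,c] i) := by
  fin_cases i <;> simp [pderiv_X, Derivation.leibniz_pow] <;> ring

lemma hessL (d : ℕ) (a b c : ℂ) (p : Fin 3 → ℂ) (i j : Fin 3) :
   eval p (pderiv i (pderiv j ((C a * X 0 + C b * X 1 + C c * X 2 : MvPolynomial (Fin 3) ℂ) ^ d))) =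
    d * (d-1 : ℕ) * (a * p 0 + b * p 1 + c * p 2)^(d-1-1) * (![a,b,c] i) * (![a,b,c] j) := by
  fin_cases i <;> fin_cases j <;> simp [pderiv_X, Derivation.leibniz_pow] <;> ring

lemma minor_ne (a₁ b₁ c₁ a₂ b₂ c₂ A B y z L₁ L₂ : ℂ)
    (ha₁ : a₁ ≠ 0) (ha₂ : a₂ ≠ 0) 
    (hm₁₂ : a₁ * b₂ - a₂ * b₁ ≠ 0) (hm₁₃ : a₁ * c₂ - a₂ * c₁ ≠ 0)
    (h1 : L₁ = b₁ * y + c₁ * z) (h2 : L₂ = b₂ * y + c₂ * z)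
    (hL₁ : L₁ ≠ 0) (hL₂ : L₂ ≠ 0) (hA : A ≠ 0) 
    (h : a₁ * (A * L₁) + a₂ * (B * L₂) = 0) :
    (A * a₁ * a₁ + B * a₂ * a₂) * (A * b₁ * c₁ + B * b₂ * c₂)
      - (A * a₁ * b₁ + B * a₂ * b₂) * (A * a₁ * c₁ + B * a₂ * c₂) ≠ 0 := by
  obtain ⟨s, rfl⟩ : ∃ s, A = s * (a₂ * L₂) := ⟨A / (a₂ * L₂), by field_simp⟩
  have hB : B = - s * (a₁ * L₁) := by
    have : a₂ * L₂ ≠ 0 := mul_ne_zero ha₂ hL₂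
    apply mul_left_cancel₀ this
    linear_combination h
  have hs : s ≠ 0 := by rintro rfl; simp at hA
  have : (s * (a₂ * L₂) * a₁ * a₁ + B * a₂ * a₂) * (s * (a₂ * L₂) * b₁ * c₁ + B * b₂ * c₂)
      - (s * (a₂ * L₂) * a₁ * b₁ + B * a₂ * b₂) * (s * (a₂ * L₂) * a₁ * c₁ + B * a₂ * c₂) = 
      - (s^2 * a₁ * a₂ * (a₁ * b₂ - a₂ * b₁) * (a₁ * c₂ - a₂ * c₁) * L₁ * L₂) := by
    rw [hB, h1, h2]; ring
  rw [this]
  clear this hB h1 h2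
  simp [*]

lemma rank_two (H : Matrix (Fin 3) (Fin 3) ℂ) (p : Fin 3 → ℂ) (hp : p ≠ 0)
    (h : H.mulVec p = 0) (i j k l : Fin 3) (hm : H i k * H j l - H i l * H j k ≠ 0) :
    H.rank = 2 := by
  apply le_antisymm
  · have hdet : H.det = 0 := Matrix.exists_mulVec_eq_zero_iff.1 ⟨p, hp, h⟩
    have h3 : H.rank ≤ 3 := by simpa using H.rank_le_width
    by_contra hc
    have h4 : H.rank = 3 := by omega
    have hk := LinearMap.finrank_range_add_finrank_ker H.mulVecLin
    have h5 : Module.finrank ℂ (LinearMap.range H.mulVecLin) = 3 := h4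
    rw [h5] at hk
    have h6 : Module.finrank ℂ (LinearMap.ker H.mulVecLin) = 0 := by
      simp at hk
      simp [hk]
    rw [Submodule.finrank_eq_zero] at h6
    have : p ∈ LinearMap.ker H.mulVecLin := by simpa using h
    rw [h6] at this
    exact hp (by simpa using this)
  · have hu : IsUnit (H.submatrix ![i, j] ![k, l]) := by
      rw [Matrix.isUnit_iff_isUnit_det, Matrix.det_fin_two, isUnit_iff_ne_zero]
      simpa using hm
    have := Matrix.rank_of_isUnit _ hu
    have h2 := Matrix.rank_submatrix_le H ![i, j] ![k, l]
    rw [this] at h2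
    simpa using h2

/-- Let `d ≥ 3` and `f = x^d + y^d + z^d + (a₁x + b₁y + c₁z)^d + (a₂x + b₂y + c₂z)^d`,
with all six coefficients nonzero and the three `2 × 2` minors `m₁₂ = a₁b₂ - a₂b₁`,
`m₁₃ = a₁c₂ - a₂c₁`, `m₂₃ = b₁c₂ - b₂c₁` nonzero.  Then every singular point
`p = (p₁ : p₂ : p₃)` of `V : f = 0` satisfies `m₂₃ p₁^(d-1) - m₁₃ p₂^(d-1) + m₁₂ p₃^(d-1) = 0`,
has at most one vanishing coordinate, the Hessian matrix of `f` at `p` is nonzero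
(each singularity is of type `A_m`), and if some coordinate of `p` vanishes then the
Hessian matrix at `p` has rank `2`, i.e. `p` is a node. -/
theorem stmt18 (d : ℕ) (hd : 3 ≤ d) (a₁ b₁ c₁ a₂ b₂ c₂ : ℂ)
    (ha₁ : a₁ ≠ 0) (hb₁ : b₁ ≠ 0) (hc₁ : c₁ ≠ 0)
    (ha₂ : a₂ ≠ 0) (hb₂ : b₂ ≠ 0) (hc₂ : c₂ ≠ 0)
    (hm₁₂ : a₁ * b₂ - a₂ * b₁ ≠ 0) (hm₁₃ : a₁ * c₂ - a₂ * c₁ ≠ 0)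
    (hm₂₃ : b₁ * c₂ - b₂ * c₁ ≠ 0)
    (f : MvPolynomial (Fin 3) ℂ)
    (hf : f = (X 0) ^ d + (X 1) ^ d + (X 2) ^ d
      + (C a₁ * X 0 + C b₁ * X 1 + C c₁ * X 2) ^ d
      + (C a₂ * X 0 + C b₂ * X 1 + C c₂ * X 2) ^ d) :
    ∀ p : Fin 3 → ℂ, p ≠ 0 → (∀ i, eval p (pderiv i f) = 0) →
      ((b₁ * c₂ - b₂ * c₁) * (p 0) ^ (d - 1) - (a₁ * c₂ - a₂ * c₁) * (p 1) ^ (d - 1)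
        + (a₁ * b₂ - a₂ * b₁) * (p 2) ^ (d - 1) = 0) ∧
      (∀ i j : Fin 3, i ≠ j → p i = 0 → p j ≠ 0) ∧
      (Matrix.of fun i j : Fin 3 => eval p (pderiv i (pderiv j f))) ≠ 0 ∧
      ((∃ i, p i = 0) →
        (Matrix.of fun i j : Fin 3 => eval p (pderiv i (pderiv j f))).rank = 2) := by
  intro p hp hg
  obtain ⟨k, rfl⟩ : ∃ k, d = k + 2 := ⟨d - 2, by omega⟩
  have hk : k ≠ 0 := by omega
  have hf' : f = (C 1 * X 0 + C 0 * X 1 + C 0 * X 2) ^ (k + 2)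
      + (C 0 * X 0 + C 1 * X 1 + C 0 * X 2) ^ (k + 2)
      + (C 0 * X 0 + C 0 * X 1 + C 1 * X 2) ^ (k + 2)
      + (C a₁ * X 0 + C b₁ * X 1 + C c₁ * X 2) ^ (k + 2)
      + (C a₂ * X 0 + C b₂ * X 1 + C c₂ * X 2) ^ (k + 2) := by
    rw [hf]; simp
  clear hf
  set L₁ := a₁ * p 0 + b₁ * p 1 + c₁ * p 2 with hL₁
  set L₂ := a₂ * p 0 + b₂ * p 1 + c₂ * p 2 with hL₂
  have hk2 : ((k : ℂ) + 2) ≠ 0 := by exact_mod_cast (by omega : k + 2 ≠ 0)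
  have hk1 : ((k : ℂ) + 1) ≠ 0 := by exact_mod_cast (by omega : k + 1 ≠ 0)
  have g : ∀ i, (p i) ^ (k + 1) + L₁ ^ (k + 1) * ![a₁, b₁, c₁] i
      + L₂ ^ (k + 1) * ![a₂, b₂, c₂] i = 0 := by
    intro i
    have := hg i
    rw [hf'] at this
    simp only [map_add, gradL, ← hL₁, ← hL₂] at this
    apply mul_left_cancel₀ hk2
    rw [mul_zero, ← this]
    fin_cases i <;> simp <;> ring
  have hH : ∀ i j, eval p (pderiv i (pderiv j f)) = (k + 2) * (k + 1) *
      ((if i = j then (p i) ^ k else 0) + L₁ ^ k * ![a₁, b₁, c₁] i * ![a₁, b₁, c₁] j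
        + L₂ ^ k * ![a₂, b₂, c₂] i * ![a₂, b₂, c₂] j) := by
    intro i j
    rw [hf']
    simp only [map_add, hessL, ← hL₁, ← hL₂]
    fin_cases i <;> fin_cases j <;> simp <;> ring
  have g0 := g 0
  have g1 := g 1
  have g2 := g 2
  simp at g0 g1 g2
  have e1 : (b₁ * c₂ - b₂ * c₁) * (p 0) ^ (k + 1) - (a₁ * c₂ - a₂ * c₁) * (p 1) ^ (k + 1)
        + (a₁ * b₂ - a₂ * b₁) * (p 2) ^ (k + 1) = 0 := by
    linear_combination (b₁ * c₂ - b₂ * c₁) * g0 - (a₁ * c₂ - a₂ * c₁) * g1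
      + (a₁ * b₂ - a₂ * b₁) * g2
  have hp' : ¬ (p 0 = 0 ∧ p 1 = 0 ∧ p 2 = 0) := by
    rintro ⟨h0, h1, h2⟩
    apply hp
    ext i
    fin_cases i <;> assumption
  have e01 : p 0 = 0 → p 1 ≠ 0 := by
    intro h0 h1
    rw [h0, h1] at e1
    simp [hm₁₂] at e1
    exact hp' ⟨h0, h1, e1⟩
  have e02 : p 0 = 0 → p 2 ≠ 0 := by
    intro h0 h1
    rw [h0, h1] at e1
    simp [hm₁₃] at e1
    exact hp' ⟨h0, e1, h1⟩
  have e12 : p 1 = 0 → p 2 ≠ 0 := by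
    intro h0 h1
    rw [h0, h1] at e1
    simp [hm₂₃] at e1
    exact hp' ⟨e1, h0, h1⟩
  have hLL : ¬ (L₁ = 0 ∧ L₂ = 0) := by
    rintro ⟨h1, h2⟩
    rw [h1, h2] at g0 g1 g2
    simp at g0 g1 g2
    exact hp' ⟨g0, g1, g2⟩
  have hLi : ∀ i, p i = 0 → L₁ ≠ 0 ∧ L₂ ≠ 0 := by
    intro i hi
    have := g i
    rw [hi] at this
    constructor
    · intro h
      rw [h] at this
      apply hLL ⟨h, ?_⟩
      fin_cases i <;> simpa [ha₂, hb₂, hc₂] using this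
    · intro h
      rw [h] at this
      apply hLL ⟨?_, h⟩
      fin_cases i <;> simpa [ha₁, hb₁, hc₁] using this
  refine ⟨e1, ?_, ?_, ?_⟩
  · intro i j hij hi hj
    fin_cases i <;> fin_cases j <;> simp at hij hi hj <;> first
      | exact e01 hi hj
      | exact e01 hj hi
      | exact e02 hi hj
      | exact e02 hj hi
      | exact e12 hi hj
      | exact e12 hj hi
  · intro h0
    have z : ∀ i j, eval p (pderiv i (pderiv j f)) = 0 := fun i j => congrFun (congrFun h0 i) j
    have z1 := z 0 1
    have z2 := z 0 2
    rw [hH] at z1 z2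
    simp [hk1, hk2] at z1 z2
    apply hLL
    constructor
    · have : L₁ ^ k * (a₁ * a₂ * (b₁ * c₂ - b₂ * c₁)) = 0 := by
        linear_combination a₂ * c₂ * z1 - a₂ * b₂ * z2
      simpa [ha₁, ha₂, hm₂₃, hk] using this
    · have : L₂ ^ k * (a₁ * a₂ * (b₁ * c₂ - b₂ * c₁)) = 0 := by
        linear_combination a₁ * b₁ * z2 - a₁ * c₁ * z1
      simpa [ha₁, ha₂, hm₂₃, hk] using this
  · rintro ⟨i, hi⟩
    obtain ⟨n1, n2⟩ := hLi i hi
    have hmul : (Matrix.of fun i j : Fin 3 => eval p (pderiv i (pderiv j f))).mulVec p = 0 := by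
      ext i
      simp only [Matrix.mulVec, dotProduct, Fin.sum_univ_three, Matrix.of_apply, hH, Pi.zero_apply]
      have := g i
      fin_cases i <;> simp at this ⊢
      · linear_combination ((k : ℂ) + 2) * (k + 1) * this - ((k : ℂ) + 2) * (k + 1) *
          (L₁ ^ k * a₁ * hL₁ + L₂ ^ k * a₂ * hL₂)
      · linear_combination ((k : ℂ) + 2) * (k + 1) * this - ((k : ℂ) + 2) * (k + 1) *
          (L₁ ^ k * b₁ * hL₁ + L₂ ^ k * b₂ * hL₂)
      · linear_combination ((k : ℂ) + 2) * (k + 1) * this - ((k : ℂ) + 2) * (k + 1) *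
          (L₁ ^ k * c₁ * hL₁ + L₂ ^ k * c₂ * hL₂)
    have hA : L₁ ^ k ≠ 0 := pow_ne_zero _ n1
    have key : ∀ M N : ℂ, M - N ≠ 0 → ∀ q r s t : ℂ, q * r = M → s * t = N →
        ((k : ℂ) + 2) * (k + 1) * q * (((k : ℂ) + 2) * (k + 1) * r)
        - ((k : ℂ) + 2) * (k + 1) * s * (((k : ℂ) + 2) * (k + 1) * t) ≠ 0 := by
      rintro _ _ h q r s t rfl rfl h'
      apply h
      apply mul_left_cancel₀ (pow_ne_zero 2 (mul_ne_zero hk2 hk1))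
      linear_combination h'
    fin_cases i
    · simp only [Fin.zero_eta] at hi
      rw [hi] at g0 hL₁ hL₂
      have := minor_ne a₁ b₁ c₁ a₂ b₂ c₂ (L₁ ^ k) (L₂ ^ k) (p 1) (p 2) L₁ L₂ ha₁ ha₂ hm₁₂ hm₁₃
        (by rw [hL₁]; ring) (by rw [hL₂]; ring) n1 n2 hA
        (by rw [← pow_succ, ← pow_succ]; linear_combination g0)
      apply rank_two _ p hp hmul 0 1 0 2
      simp only [Matrix.of_apply, hH]
      apply key _ _ this <;> simp [hi, hk] <;> ring
    · simp only [Fin.mk_one] at hi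
      rw [hi] at g1 hL₁ hL₂
      have := minor_ne b₁ a₁ c₁ b₂ a₂ c₂ (L₁ ^ k) (L₂ ^ k) (p 0) (p 2) L₁ L₂ hb₁ hb₂
        (fun h => hm₁₂ (by linear_combination -h)) hm₂₃
        (by rw [hL₁]; ring) (by rw [hL₂]; ring) n1 n2 hA
        (by rw [← pow_succ, ← pow_succ]; linear_combination g1)
      apply rank_two _ p hp hmul 1 0 1 2
      simp only [Matrix.of_apply, hH]
      apply key _ _ this <;> simp [hi, hk] <;> ring
    · simp only [Fin.reduceFinMk] at hi
      rw [hi] at g2 hL₁ hL₂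
      have := minor_ne c₁ a₁ b₁ c₂ a₂ b₂ (L₁ ^ k) (L₂ ^ k) (p 0) (p 1) L₁ L₂ hc₁ hc₂
        (fun h => hm₁₃ (by linear_combination -h)) (fun h => hm₂₃ (by linear_combination -h))
        (by rw [hL₁]; ring) (by rw [hL₂]; ring) n1 n2 hA
        (by rw [← pow_succ, ← pow_succ]; linear_combination g2)
      apply rank_two _ p hp hmul 2 0 2 1
      simp only [Matrix.of_apply, hH]
      apply key _ _ this <;> simp [hi, hk] <;> ring
end

section
/- Let n ≥ 2, d ≥ 3, and let b_1, …, b_{n+1} be nonzero complex numbers defining the hyperplane H : b_1y_1 + ⋯ + b_{n+1}y_{n+1} = 0 in ℙ^n. Let F : y_1^d + ⋯ + y_{n+1}^d = 0 be the Fermat hypersurface. Then the set of tangency points of H with F, namely the points p ∈ ℙ^n with p on F ∩ H and with (p_1^{d−1}, …, p_{n+1}^{d−1}) proportional to (b_1, …, b_{n+1}), is finite, every such tangency point has all of its homogeneous coordinates nonzero, and at each tangency point p the hyperplane section F ∩ H has an A_1 singularity: the quadratic part of the local equation of F ∩ H at p (in any affine chart of H) is a nondegenerate quadratic form in n−1 variables.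 -/
theorem aux_ne (n d : ℕ) (hd : 3 ≤ d)
    (b : Fin (n + 1) → ℂ) (hb : ∀ i, b i ≠ 0) (p : Fin (n + 1) → ℂ) (hp : p ≠ 0) (c : ℂ)
    (hc : ∀ i, p i ^ (d - 1) = c * b i) : c ≠ 0 ∧ ∀ i, p i ≠ 0 := by
  have hc0 : c ≠ 0 := by
    rintro rfl
    apply hp
    funext i
    have := hc i
    rw [zero_mul] at this
    exact pow_eq_zero_iff (by omega) |>.1 this
  refine ⟨hc0, fun i hi => ?_⟩
  have := hc i
  rw [hi, zero_pow (by omega)] at this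
  exact mul_ne_zero hc0 (hb i) this.symm

theorem aux_fin (m : ℕ) (hm : 0 < m) (a : ℂ) : {z : ℂ | z ^ m = a}.Finite := by
  refine (Polynomial.nthRoots m a).toFinset.finite_toSet.subset ?_
  intro z hz
  simpa [Polynomial.mem_nthRoots hm] using hz

/-- Let `n ≥ 2`, `d ≥ 3`, and `H : b₁ y₁ + ⋯ + b_{n+1} y_{n+1} = 0` a hyperplane in `ℙⁿ`
with all `b_i` nonzero, and `F : y₁^d + ⋯ + y_{n+1}^d = 0` the Fermat hypersurface.
Then the set of tangency points of `H` with `F` (points `p` on `F ∩ H` whose gradient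
`(p_i^(d-1))_i` is proportional to `(b_i)_i`) is finite; every such tangency point has
all coordinates nonzero; and at each tangency point the hyperplane section `F ∩ H` has
an `A₁` singularity: the quadratic part of the local equation, i.e. the restriction of
the bilinear form `(v, w) ↦ ∑ p_i^(d-2) v_i w_i` to the hyperplane
`{v | ∑ b_i v_i = 0}` modulo the line `ℂ p`, is nondegenerate (its radical on the
hyperplane is exactly `ℂ p`). -/
theorem stmt19 (n d : ℕ) (hn : 2 ≤ n) (hd : 3 ≤ d)
    (b : Fin (n + 1) → ℂ) (hb : ∀ i, b i ≠ 0) :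
    {x : Projectivization ℂ (Fin (n + 1) → ℂ) |
        (∑ i, x.rep i ^ d = 0) ∧ (∑ i, b i * x.rep i = 0) ∧
        ∃ c : ℂ, ∀ i, x.rep i ^ (d - 1) = c * b i}.Finite ∧
    ∀ p : Fin (n + 1) → ℂ, p ≠ 0 →
      (∑ i, p i ^ d = 0) → (∑ i, b i * p i = 0) →
      (∃ c : ℂ, ∀ i, p i ^ (d - 1) = c * b i) →
      (∀ i, p i ≠ 0) ∧
      (∀ v : Fin (n + 1) → ℂ, (∑ i, b i * v i = 0) →
        (∀ w : Fin (n + 1) → ℂ, (∑ i, b i * w i = 0) →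
          (∑ i, p i ^ (d - 2) * v i * w i) = 0) →
        ∃ t : ℂ, v = t • p) := by
  constructor
  · refine Set.Finite.of_injOn (f := fun x i => x.rep i / x.rep 0)
      (t := Set.pi Set.univ (fun i => {z : ℂ | z ^ (d - 1) = b i / b 0})) ?_ ?_
      (Set.Finite.pi fun i => aux_fin (d - 1) (by omega) _)
    · rintro x ⟨-, -, c, hc⟩ i -
      obtain ⟨hc0, h0⟩ := aux_ne n d hd b hb _ x.rep_nonzero c hc
      simp only [Set.mem_setOf_eq, div_pow, hc]
      have := hb 0
      field_simp
    · rintro x ⟨-, -, c, hc⟩ y ⟨-, -, c', hc'⟩ hxy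
      obtain ⟨hc0, h0⟩ := aux_ne n d hd b hb _ x.rep_nonzero c hc
      obtain ⟨hc0', h0'⟩ := aux_ne n d hd b hb _ y.rep_nonzero c' hc'
      rw [← x.mk_rep, ← y.mk_rep, Projectivization.mk_eq_mk_iff']
      refine ⟨x.rep 0 / y.rep 0, ?_⟩
      funext i
      have h := congrFun hxy i
      have h1 := h0 0
      have h2 := h0' 0
      simp only [Pi.smul_apply, smul_eq_mul] at h ⊢
      field_simp at h ⊢
      linear_combination -h
  · rintro p hp - - ⟨c, hc⟩
    obtain ⟨hc0, h0⟩ := aux_ne n d hd b hb p hp c hc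
    refine ⟨h0, fun v _ hw => ⟨v 0 / p 0, ?_⟩⟩
    funext i
    have h := hw (Pi.single i (b 0) - Pi.single 0 (b i)) (by
      simp [mul_sub, Finset.sum_sub_distrib, Pi.single_apply, mul_comm])
    simp only [Pi.sub_apply, mul_sub, Finset.sum_sub_distrib, Pi.single_apply, mul_ite, mul_zero,
      Finset.sum_ite_eq', Finset.mem_univ, if_true] at h
    obtain ⟨e, rfl⟩ : ∃ e, d = e + 2 := ⟨d - 2, by omega⟩
    simp only [Nat.add_sub_cancel, show e + 2 - 1 = e + 1 by omega] at h hc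
    have hi := hc i
    have hz := hc 0
    have h1 := h0 0
    have key : (p i ^ e * p 0 ^ e) * (v i * p 0 - v 0 * p i) = 0 := by
      linear_combination c * h + p i ^ e * v i * hz - p 0 ^ e * v 0 * hi
    have := (mul_eq_zero.1 key).resolve_left
      (mul_ne_zero (pow_ne_zero _ (h0 i)) (pow_ne_zero _ h1))
    simp only [Pi.smul_apply, smul_eq_mul]
    field_simp
    linear_combination this
end
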